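/- Suppose 1 ≤ s ≤ r. Let λ' be an integer with λ'·λ_{j_s} ≡ 1 (mod m), and suppose (a_0, …, a_{s−1}) is an arithmetic pure gap at (j_0, …, j_{s−1}). Then (a_0, …, a_{s−1}, 1) is an arithmetic pure gap at (j_0, …, j_{s−1}, j_s) if and only if ∑_{i=0}^{s−1} ⌊(a_i − λ'·λ_{j_i})/m⌋ + ⌊(1 − λ'·λ_{j_s})/m⌋ + ∑_{i=s+1}^{r} ⌊(−λ'·λ_{j_i})/m⌋ ≤ −1. -/

import Mathlib

open Finset

/-- Floor of the rational number `x / m`. -/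
noncomputable def fdivq (m : ℕ) (x : ℤ) : ℤ := ⌊(x : ℚ) / (m : ℚ)⌋

/-- The quantity `∑_{i=0}^{n-1} ⌊(a_i + t·λ_{c i})/m⌋ + ∑_{w ∉ range c} ⌊t·λ_w/m⌋`. -/
noncomputable def gapSum (m r n : ℕ) (lam : Fin (r + 1) → ℤ)
    (c : Fin n → Fin (r + 1)) (a : Fin n → ℤ) (t : ℤ) : ℤ :=
  (∑ i : Fin n, fdivq m (a i + t * lam (c i))) +
    ∑ w ∈ Finset.univ \ Finset.image c Finset.univ, fdivq m (t * lam w)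

/-- `(a 0, …, a (n-1))` is an *arithmetic pure gap* at the (pairwise distinct) indices
`c 0, …, c (n-1)` of `{0,…,r}`: the entries are nonnegative and for every
`t ∈ {0,…,m-1}` exactly one of the two Bartoli–Quoos–Zini conditions holds. -/
noncomputable def IsArithPureGap (m r n : ℕ) (lam : Fin (r + 1) → ℤ)
    (c : Fin n → Fin (r + 1)) (a : Fin n → ℤ) : Prop :=
  (∀ i, 0 ≤ a i) ∧
    ∀ t : ℤ, 0 ≤ t → t ≤ (m : ℤ) - 1 →
      Xor' (gapSum m r n lam c a t < 0)
        (0 ≤ gapSum m r n lam c a t ∧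
          ∀ i : Fin n, fdivq m (a i + t * lam (c i)) = fdivq m (a i + t * lam (c i) - 1))

theorem fdivq_eq_ediv (m : ℕ) (x : ℤ) : fdivq m x = x / (m : ℤ) := by
  unfold fdivq
  rw [← Rat.floor_intCast_div_natCast]

/-- If `c` is injective, a sum over all indices splits into the part on the range of `c`
and the part on its complement. -/
theorem sum_add_sum_sdiff_image {r n : ℕ} {c : Fin n → Fin (r + 1)} (hc : Function.Injective c)
    (f : Fin (r + 1) → ℤ) :
    ∑ i, f (c i) + ∑ w ∈ univ \ image c univ, f w = ∑ w, f w := by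
  rw [← sum_sdiff (subset_univ (image c univ)), sum_image hc.injOn, add_comm]

theorem gapSum_add_mul {m r n : ℕ} (hm : m ≠ 0) {lam : Fin (r + 1) → ℤ} (hsum : ∑ i, lam i = 0)
    {c : Fin n → Fin (r + 1)} (hc : Function.Injective c) (a : Fin n → ℤ) (t k : ℤ) :
    gapSum m r n lam c a (t + m * k) = gapSum m r n lam c a t := by
  have hdiv (x l : ℤ) : fdivq m (x + m * (k * l)) = fdivq m x + k * l := by
    simp only [fdivq_eq_ediv]
    exact Int.add_mul_ediv_left _ _ (by exact_mod_cast hm)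
  have h₁ (i : Fin n) : fdivq m (a i + (t + m * k) * lam (c i)) =
      fdivq m (a i + t * lam (c i)) + k * lam (c i) := by
    rw [← hdiv]; ring_nf
  have h₂ (w : Fin (r + 1)) : fdivq m ((t + m * k) * lam w) =
      fdivq m (t * lam w) + k * lam w := by
    rw [← hdiv]; ring_nf
  have h := sum_add_sum_sdiff_image hc fun w => k * lam w
  simp only [← mul_sum, hsum, mul_zero] at h
  simp only [gapSum, h₁, h₂, sum_add_distrib]
  simp only [← mul_sum]
  linarith

/-- Adjoining a new index with entry `1` changes only the summand at that index. -/
theorem gapSum_snoc_one {m r s : ℕ} (lam : Fin (r + 1) → ℤ) {c : Fin (s + 1) → Fin (r + 1)}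
    (hc : Function.Injective c) {cs : Fin s → Fin (r + 1)} (hcs : ∀ i, cs i = c i.castSucc)
    (a : Fin s → ℤ) (t : ℤ) :
    gapSum m r (s + 1) lam c (Fin.snoc a 1) t =
      gapSum m r s lam cs a t +
        (fdivq m (1 + t * lam (c (Fin.last s))) - fdivq m (t * lam (c (Fin.last s)))) := by
  have hcs' : Function.Injective cs := fun i j h => by
    rw [hcs, hcs] at h
    exact Fin.castSucc_injective s (hc h)
  have h := sum_add_sum_sdiff_image hc fun w => fdivq m (t * lam w)
  rw [← sum_add_sum_sdiff_image hcs', Fin.sum_univ_castSucc] at h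
  simp only [← hcs] at h
  simp only [gapSum, Fin.sum_univ_castSucc, Fin.snoc_castSucc, Fin.snoc_last, ← hcs]
  linarith

theorem fdivq_one_add_eq_iff {m : ℕ} (hm : m ≠ 0) (x : ℤ) :
    fdivq m (1 + x) = fdivq m x ↔ ¬ (m : ℤ) ∣ 1 + x := by
  have hm' : (0 : ℤ) < m := by positivity
  simp only [fdivq_eq_ediv]
  have h₁ := Int.emod_add_mul_ediv x m
  have h₂ := Int.emod_nonneg x hm'.ne'
  have h₃ := Int.emod_lt_of_pos x hm'
  constructor
  · rintro h ⟨k, hk⟩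
    rw [hk, Int.mul_ediv_cancel_left _ hm'.ne'] at h
    subst h
    linarith
  · intro h
    have h₄ : x % m + 1 ≠ m := fun h₄ => h ⟨x / m + 1, by linarith⟩
    rw [Int.ediv_eq_iff_of_pos hm']
    have h₅ : x % m + 1 < m := lt_of_le_of_ne h₃ h₄
    constructor <;> linarith

theorem dvd_one_add_mul_iff {m l l' : ℤ} (h : l' * l ≡ 1 [ZMOD m]) (t : ℤ) :
    m ∣ 1 + t * l ↔ m ∣ t + l' := by
  obtain ⟨k, hk⟩ := h.dvd
  constructor
  · rintro ⟨q, hq⟩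
    exact ⟨q * l' + t * k, by linear_combination l' * hq + t * hk⟩
  · rintro ⟨q, hq⟩
    exact ⟨q * l + k, by linear_combination l * hq + hk⟩

/-- Extending a pure gap at `s` places by the last coordinate `1`
(first part of Theorem find_another_pure_gap). -/
theorem snoc_one_pureGap_iff (m r : ℕ) (hm : 2 ≤ m) (hr : 1 ≤ r)
    (lam : Fin (r + 1) → ℤ) (hlam : ∀ i, lam i ≠ 0) (hsum : ∑ i, lam i = 0)
    (s : ℕ) (hs1 : 1 ≤ s) (hsr : s ≤ r) (perm : Equiv.Perm (Fin (r + 1)))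
    (c : Fin (s + 1) → Fin (r + 1))
    (hc : ∀ i, c i = perm (Fin.castLE (Nat.succ_le_succ hsr) i))
    (cs : Fin s → Fin (r + 1)) (hcs : ∀ i, cs i = c i.castSucc)
    (hgcd : ∀ i, Int.gcd (m : ℤ) (lam (c i)) = 1)
    (lam' : ℤ) (hinv : Int.ModEq (m : ℤ) (lam' * lam (c (Fin.last s))) 1)
    (a₀ : Fin s → ℤ)
    (hpure : IsArithPureGap m r s lam cs a₀) :
    IsArithPureGap m r (s + 1) lam c (Fin.snoc a₀ 1) ↔
      (∑ i : Fin s, fdivq m (a₀ i - lam' * lam (cs i))) +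
          fdivq m (1 - lam' * lam (c (Fin.last s))) +
          (∑ w ∈ Finset.univ \ Finset.image c Finset.univ,
            fdivq m (-lam' * lam w)) ≤ -1 := by
  have hm0 : m ≠ 0 := by omega
  have hm' : (0 : ℤ) < m := by positivity
  have hc_inj : Function.Injective c := fun i j h => by
    rw [hc, hc] at h
    exact Fin.castLE_injective _ (perm.injective h)
  have hrhs : (∑ i : Fin s, fdivq m (a₀ i - lam' * lam (cs i))) +
      fdivq m (1 - lam' * lam (c (Fin.last s))) +
      (∑ w ∈ univ \ image c univ, fdivq m (-lam' * lam w)) =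
      gapSum m r (s + 1) lam c (Fin.snoc a₀ 1) (-lam') := by
    simp only [gapSum, Fin.sum_univ_castSucc, Fin.snoc_castSucc, Fin.snoc_last, ← hcs, neg_mul,
      ← sub_eq_add_neg]
  have hlast (t : ℤ) : fdivq m (1 + t * lam (c (Fin.last s))) =
      fdivq m (1 + t * lam (c (Fin.last s)) - 1) ↔ ¬ (m : ℤ) ∣ t + lam' := by
    rw [add_sub_cancel_left, fdivq_one_add_eq_iff hm0, dvd_one_add_mul_iff hinv]
  rw [hrhs]
  constructor
  · rintro ⟨-, h⟩
    have hmod : -lam' % m = -lam' + m * -(-lam' / m) := by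
      linarith [Int.emod_add_mul_ediv (-lam') m]
    have ht := h (-lam' % m) (Int.emod_nonneg _ hm'.ne')
      (Int.le_sub_one_of_lt (Int.emod_lt_of_pos _ hm'))
    have hnot : ¬ ∀ i : Fin (s + 1),
        fdivq m ((Fin.snoc a₀ 1 : Fin (s + 1) → ℤ) i + -lam' % m * lam (c i)) =
          fdivq m ((Fin.snoc a₀ 1 : Fin (s + 1) → ℤ) i + -lam' % m * lam (c i) - 1) := by
      intro hall
      have hl := hall (Fin.last s)
      rw [Fin.snoc_last, hlast] at hl
      exact hl ⟨-(-lam' / m), by rw [hmod]; ring⟩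
    rw [hmod, gapSum_add_mul hm0 hsum hc_inj, ← hmod] at ht
    rcases ht with ⟨h, -⟩ | ⟨⟨-, h⟩, -⟩
    · exact Int.le_sub_one_of_lt h
    · exact absurd h hnot
  · intro hneg
    refine ⟨Fin.lastCases (by simp) (by simpa using hpure.1), fun t ht₀ ht₁ => ?_⟩
    by_cases hd : (m : ℤ) ∣ t + lam'
    · obtain ⟨k, hk⟩ := hd
      have hG := gapSum_add_mul hm0 hsum hc_inj (Fin.snoc a₀ 1) (-lam') k
      rw [show -lam' + m * k = t by linarith] at hG
      exact Or.inl ⟨by omega, fun h => by omega⟩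
    · have hl := (hlast t).2 hd
      have hx := hpure.2 t ht₀ ht₁
      have hG := gapSum_snoc_one (m := m) lam hc_inj hcs a₀ t
      rw [hl, add_sub_cancel_left, sub_self, add_zero] at hG
      simpa only [hG, Fin.forall_fin_succ', Fin.snoc_castSucc, Fin.snoc_last, ← hcs, hl,
        and_true] using hx
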